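/- For every λ ∈ D, the reproducing kernel k_λ^b of H(b), defined by k_λ^b(z) = (1 − conj(b(λ))·b(z))/(1 − conj(λ)·z) for z ∈ D, is cyclic for S_b. -/

import Mathlib

open MeasureTheory Complex Filter Set Metric
open scoped ComplexConjugate

noncomputable section

/-- The circle group `ℝ / 2πℤ`, parametrizing the unit circle `𝕋`. -/
instance fact_two_pi_pos : Fact (0 < 2 * Real.pi) := ⟨by positivity⟩

abbrev Tc : Type := AddCircle (2 * Real.pi)

/-- Normalized Lebesgue measure on the circle. -/
def m : Measure Tc := AddCircle.haarAddCircle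

instance : IsProbabilityMeasure m := by unfold m; infer_instance

/-- The point `e^{iθ}` of the unit circle corresponding to `θ ∈ ℝ/2πℤ`. -/
def bd (θ : Tc) : ℂ := (AddCircle.toCircle θ : ℂ)

/-- The open unit disc. -/
abbrev uDisc : Set ℂ := Metric.ball (0 : ℂ) 1

/-- A function holomorphic on the open unit disc. -/
def HolDisc (f : ℂ → ℂ) : Prop := DifferentiableOn ℂ f uDisc

/-- `F` is the radial (a.e.) boundary function of `f`. -/
def IsBdry (f : ℂ → ℂ) (F : Tc → ℂ) : Prop :=
  ∀ᵐ θ ∂m, Tendsto (fun r : ℝ => f ((r : ℂ) * bd θ)) (nhdsWithin 1 (Set.Iio 1)) (nhds (F θ))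

/-- Membership in the Hardy space `H^p` of the unit disc, `0 < p < ∞`. -/
def MemHp (p : ℝ) (f : ℂ → ℂ) : Prop :=
  HolDisc f ∧ ∃ C : ℝ, ∀ r : ℝ, 0 ≤ r → r < 1 →
    (∫ θ : Tc, ‖f ((r : ℂ) * bd θ)‖ ^ p ∂m) ≤ C

/-- Membership in `H^∞`: bounded holomorphic functions on the disc. -/
def MemHinf (f : ℂ → ℂ) : Prop := HolDisc f ∧ ∃ C : ℝ, ∀ z ∈ uDisc, ‖f z‖ ≤ C

/-- Outer functions on the unit disc. -/
def OuterFn (f : ℂ → ℂ) : Prop :=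
  HolDisc f ∧ ∃ (α : ℂ) (w : Tc → ℝ), ‖α‖ = 1 ∧ (∀ θ, 0 ≤ w θ) ∧
    Integrable (fun θ => Real.log (w θ)) m ∧
    ∀ z ∈ uDisc,
      f z = α * Complex.exp (∫ θ : Tc, ((bd θ + z) / (bd θ - z)) * (Real.log (w θ) : ℂ) ∂m)

/-- Inner functions: `Θ` holomorphic bounded by one, with unimodular boundary values `Θs`. -/
def InnerFn (Θ : ℂ → ℂ) (Θs : Tc → ℂ) : Prop :=
  HolDisc Θ ∧ (∀ z ∈ uDisc, ‖Θ z‖ ≤ 1) ∧ IsBdry Θ Θs ∧ (∀ᵐ θ ∂m, ‖Θs θ‖ = 1)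

/-- `L²(𝕋, m)`. -/
abbrev L2 : Type := Lp ℂ 2 m

/-- The Hardy space `H²`, viewed inside `L²(𝕋)` as the functions whose negative
Fourier coefficients vanish. -/
def H2 : Set L2 := {F | ∀ n : ℤ, n < 0 → fourierCoeff (F : Tc → ℂ) n = 0}

/-- The Cauchy kernel `k_λ(z) = 1/(1 - conj(λ) z)`. -/
def ker (lam z : ℂ) : ℂ := (1 - conj lam * z)⁻¹

/-- Divergence of `Σ (1 - |λ_n|)` (for `λ_n` in the unit disc this is the negation of
the Blaschke condition). -/
def NotBlaschke (lam : ℕ → ℂ) : Prop := ¬ Summable (fun n => 1 - ‖lam n‖)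

/-- A bundle recording: a non-constant function `b` in the closed unit ball of `H^∞`
with `log(1 - |b|) ∈ L¹(𝕋)`, its Pythagorean mate `a` (outer, `a(0) > 0`,
`|a|² + |b|² = 1` a.e.), together with their boundary functions `bs`, `as'`. -/
structure BPair where
  b : ℂ → ℂ
  a : ℂ → ℂ
  bs : Tc → ℂ
  as' : Tc → ℂ
  b_hol : HolDisc b
  b_le_one : ∀ z ∈ uDisc, ‖b z‖ ≤ 1
  b_nonconst : ¬ ∃ c : ℂ, ∀ z ∈ uDisc, b z = c
  b_bdry : IsBdry b bs
  log_int : Integrable (fun θ => Real.log (1 - ‖bs θ‖)) m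
  a_outer : OuterFn a
  a_bdry : IsBdry a as'
  a0_pos : ∃ r : ℝ, 0 < r ∧ a 0 = (r : ℂ)
  pyth : ∀ᵐ θ ∂m, ‖as' θ‖ ^ 2 + ‖bs θ‖ ^ 2 = 1

/-- The defining relation of `H(b)`: `T_{conj b} F = T_{conj a} F⁺`, i.e. all nonnegative
Fourier coefficients of `conj(b)·F - conj(a)·F⁺` vanish, with `F, F⁺ ∈ H²`. -/
def HbMem (P : BPair) (F Fp : L2) : Prop :=
  F ∈ H2 ∧ Fp ∈ H2 ∧ ∀ n : ℤ, 0 ≤ n →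
    fourierCoeff (fun θ => conj (P.bs θ) * (F : Tc → ℂ) θ - conj (P.as' θ) * (Fp : Tc → ℂ) θ) n = 0

/-- The ambient Hilbert space `L² ×_2 L²` in which `H(b)` embeds isometrically via
`f ↦ (f, f⁺)`; its norm is `‖(F, F⁺)‖² = ‖F‖₂² + ‖F⁺‖₂²`, the `H(b)` norm. -/
abbrev HbP : Type := WithLp 2 (L2 × L2)

def fst2 (p : HbP) : L2 := ((WithLp.equiv 2 (L2 × L2)) p).1
def snd2 (p : HbP) : L2 := ((WithLp.equiv 2 (L2 × L2)) p).2

/-- The de Branges–Rovnyak space `H(b)`, as the set of pairs `(f, f⁺)`. -/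
def HbSet (P : BPair) : Set HbP := {p | HbMem P (fst2 p) (snd2 p)}

/-- `q` represents the element `φ · f` of `H(b)`, where `p` represents `f` and `φs` is a
boundary function: `q ∈ H(b)` and the first component of `q` is `φs` times that of `p`. -/
def MulRep (P : BPair) (φs : Tc → ℂ) (p q : HbP) : Prop :=
  q ∈ HbSet P ∧ (fst2 q : Tc → ℂ) =ᵐ[m] fun θ => φs θ * (fst2 p : Tc → ℂ) θ

/-- `Zf` is the family of elements `z^n·f`, `n ≥ 0`, of `H(b)`, where `p` represents `f`. -/
def ZFamily (P : BPair) (p : HbP) (Zf : ℕ → HbP) : Prop :=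
  ∀ n : ℕ, MulRep P (fun θ => (bd θ) ^ n) p (Zf n)

/-- `f` (represented by the pair `p`) is cyclic for `S_b`: the linear span of
`{z^n f : n ≥ 0}` is dense in `H(b)`. -/
def CyclicSb (P : BPair) (p : HbP) : Prop :=
  p ∈ HbSet P ∧ ∀ Zf : ℕ → HbP, ZFamily P p Zf →
    closure (↑(Submodule.span ℂ (Set.range Zf)) : Set HbP) = HbSet P

/-- `FK` is the family of elements `f·k_{λ_n}`, `n ≥ 0`, of `H(b)`. -/
def KFamily (P : BPair) (lam : ℕ → ℂ) (p : HbP) (FK : ℕ → HbP) : Prop :=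
  ∀ n : ℕ, MulRep P (fun θ => ker (lam n) (bd θ)) p (FK n)

/-- `C` is a bound for the norm of the shift `S_b` on `H(b)`. -/
def ShiftBound (P : BPair) (C : ℝ) : Prop :=
  0 ≤ C ∧ ∀ p q : HbP, p ∈ HbSet P → MulRep P (fun θ => bd θ) p q → ‖q‖ ≤ C * ‖p‖

/-- `N = ‖S_b‖`, the operator norm of the shift on `H(b)`. -/
def IsShiftNorm (P : BPair) (N : ℝ) : Prop :=
  ShiftBound P N ∧ ∀ C : ℝ, ShiftBound P C → N ≤ C

/-- `μ` is the Aleksandrov–Clark measure `μ_α` of `b`. -/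
def IsACMeasure (P : BPair) (α : ℂ) (μ : Measure Tc) : Prop :=
  IsFiniteMeasure μ ∧ ∀ z ∈ uDisc,
    (1 - ‖P.b z‖ ^ 2) / ‖1 - conj α * P.b z‖ ^ 2 = ∫ θ : Tc, (1 - ‖z‖ ^ 2) / ‖z - bd θ‖ ^ 2 ∂μ


lemma norm_bd (θ : Tc) : ‖bd θ‖ = 1 := Circle.norm_coe _

lemma bd_ne (θ : Tc) : bd θ ≠ 0 := by
  intro h; have := norm_bd θ; rw [h] at this; simp at this

@[fun_prop]
lemma continuous_bd : Continuous bd := by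
  unfold bd
  exact continuous_subtype_val.comp AddCircle.continuous_toCircle

lemma fourier_eq_bd (n : ℤ) (θ : Tc) : fourier n θ = bd θ ^ n := by
  rw [fourier_apply, AddCircle.toCircle_zsmul]; simp [bd]

lemma bd_coe (x : ℝ) : bd (x : Tc) = circleMap 0 1 x := by
  simp only [bd, AddCircle.toCircle_apply_mk, circleMap, Circle.coe_exp]
  have : (Real.pi : ℂ) ≠ 0 := by exact_mod_cast Real.pi_ne_zero
  simp

lemma circleAvg_eq {E : Type*} [NormedAddCommGroup E] [NormedSpace ℝ E] (f : ℂ → E) (R : ℝ) :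
    Real.circleAverage f 0 R = ∫ θ, f ((R : ℂ) * bd θ) ∂m := by
  unfold m
  rw [Real.circleAverage_def, AddCircle.integral_haarAddCircle,
    ← AddCircle.intervalIntegral_preimage (2 * Real.pi) 0]
  simp [bd_coe, circleMap]

lemma mul_bd_mem {r : ℝ} (hr0 : 0 ≤ r) (hr1 : r < 1) (θ : Tc) : (r : ℂ) * bd θ ∈ uDisc := by
  simp [norm_bd, abs_of_nonneg hr0, hr1]

lemma cont_dil {ψ : ℂ → ℂ} (h : HolDisc ψ) {r : ℝ} (hr0 : 0 ≤ r) (hr1 : r < 1) :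
    Continuous (fun θ : Tc => ψ ((r : ℂ) * bd θ)) := by
  have h1 : ContinuousOn ψ uDisc := h.continuousOn
  exact h1.comp_continuous (by fun_prop) (mul_bd_mem hr0 hr1)

lemma mean_val {ψ : ℂ → ℂ} (h : HolDisc ψ) {r : ℝ} (hr0 : 0 ≤ r) (hr1 : r < 1) :
    ∫ θ, ψ ((r : ℂ) * bd θ) ∂m = ψ 0 := by
  rw [← circleAvg_eq]
  apply DiffContOnCl.circleAverage
  apply DifferentiableOn.diffContOnCl
  apply h.mono
  refine closure_ball_subset_closedBall.trans ?_
  rw [abs_of_nonneg hr0]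
  exact closedBall_subset_ball hr1

lemma mean_fourier {ψ : ℂ → ℂ} (h : HolDisc ψ) {r : ℝ} (hr0 : 0 < r) (hr1 : r < 1)
    {n : ℤ} (hn : 1 ≤ n) :
    ∫ θ, fourier n θ * ψ ((r : ℂ) * bd θ) ∂m = 0 := by
  obtain ⟨k, rfl⟩ : ∃ k : ℕ, n = (k : ℤ) := ⟨n.toNat, by omega⟩
  have hk : k ≠ 0 := by omega
  have h2 : HolDisc (fun z => z ^ k * ψ z) := by
    unfold HolDisc at *; fun_prop
  have h3 := mean_val h2 hr0.le hr1
  have hr : (r : ℂ) ≠ 0 := by exact_mod_cast hr0.ne'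
  have : ∀ θ : Tc, fourier (k : ℤ) θ * ψ ((r : ℂ) * bd θ) =
     ((r : ℂ) ^ k)⁻¹ * (((r : ℂ) * bd θ) ^ k * ψ ((r : ℂ) * bd θ)) := by
    intro θ
    rw [fourier_eq_bd, zpow_natCast, mul_pow]; field_simp
  simp_rw [this]
  rw [integral_const_mul, h3]
  simp [hk]

/-- a sequence of radii tending to one -/
def rr (n : ℕ) : ℝ := 1 - 1 / ((n : ℝ) + 2)

lemma rr_pos (n : ℕ) : 0 < rr n := by
  unfold rr
  have : (1 : ℝ) / ((n : ℝ) + 2) < 1 := by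
    rw [div_lt_one (by positivity)]; have : (0:ℝ) ≤ n := by positivity
    linarith
  linarith

lemma rr_lt (n : ℕ) : rr n < 1 := by
  unfold rr
  have : (0 : ℝ) < 1 / ((n : ℝ) + 2) := by positivity
  linarith

lemma rr_tendsto1 : Tendsto rr atTop (nhds 1) := by
  have h : Tendsto (fun n : ℕ => (1 : ℝ) / ((n : ℝ) + 2)) atTop (nhds 0) := by
    have := (tendsto_one_div_add_atTop_nhds_zero_nat (𝕜 := ℝ)).comp (tendsto_add_atTop_nat 1)
    refine this.congr ?_
    intro n
    simp only [Function.comp_apply]; push_cast; congr 1; ring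
  have := h.const_sub 1
  rw [sub_zero] at this
  exact this

lemma rr_tendsto : Tendsto rr atTop (nhdsWithin 1 (Set.Iio 1)) :=
  tendsto_nhdsWithin_iff.2 ⟨rr_tendsto1, Eventually.of_forall rr_lt⟩

lemma IsBdry.seq {f : ℂ → ℂ} {F : Tc → ℂ} (h : IsBdry f F) :
    ∀ᵐ θ ∂m, Tendsto (fun n => f ((rr n : ℂ) * bd θ)) atTop (nhds (F θ)) := by
  filter_upwards [h] with θ hθ
  exact hθ.comp rr_tendsto

lemma IsBdry.aesm {f : ℂ → ℂ} {F : Tc → ℂ} (h : IsBdry f F) (hf : HolDisc f) :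
    AEStronglyMeasurable F m :=
  aestronglyMeasurable_of_tendsto_ae atTop
    (fun n => (cont_dil hf (rr_pos n).le (rr_lt n)).aestronglyMeasurable) h.seq

lemma IsBdry.norm_le {f : ℂ → ℂ} {F : Tc → ℂ} (h : IsBdry f F)
    (hb : ∀ z ∈ uDisc, ‖f z‖ ≤ 1) : ∀ᵐ θ ∂m, ‖F θ‖ ≤ 1 := by
  filter_upwards [h.seq] with θ hθ
  exact le_of_tendsto hθ.norm (Eventually.of_forall fun n => hb _ (mul_bd_mem (rr_pos n).le (rr_lt n) θ))

lemma norm_fourier_apply (n : ℤ) (θ : Tc) : ‖fourier n θ‖ = 1 := by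
  rw [fourier_eq_bd]; simp [norm_bd]

lemma IsBdry.fourier_zero {f : ℂ → ℂ} {F : Tc → ℂ} (h : IsBdry f F) (hf : HolDisc f)
    (hb : ∀ z ∈ uDisc, ‖f z‖ ≤ 1) {n : ℤ} (hn : 1 ≤ n) : ∫ θ, fourier n θ * F θ ∂m = 0 := by
  have : Tendsto (fun k => ∫ θ, fourier n θ * f ((rr k : ℂ) * bd θ) ∂m) atTop
      (nhds (∫ θ, fourier n θ * F θ ∂m)) := by
    apply tendsto_integral_of_dominated_convergence (fun _ => (1 : ℝ))
    · intro k
      exact ((map_continuous _).mul (cont_dil hf (rr_pos k).le (rr_lt k))).aestronglyMeasurable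
    · exact integrable_const _
    · intro k
      refine Eventually.of_forall fun θ => ?_
      rw [norm_mul, norm_fourier_apply, one_mul]
      exact hb _ (mul_bd_mem (rr_pos k).le (rr_lt k) θ)
    · filter_upwards [h.seq] with θ hθ
      exact hθ.const_mul _
  refine tendsto_nhds_unique this ?_
  simp_rw [mean_fourier hf (rr_pos _) (rr_lt _) hn]
  exact tendsto_const_nhds

lemma memLp_mul_bdd {φ f : Tc → ℂ} (hφ : AEStronglyMeasurable φ m) {C : ℝ} (hb : ∀ᵐ θ ∂m, ‖φ θ‖ ≤ C)
    (hf : MemLp f 2 m) : MemLp (fun θ => φ θ * f θ) 2 m := by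
  refine MemLp.of_le_mul hf (c := C) (hφ.mul hf.1) ?_
  filter_upwards [hb] with θ hθ
  rw [norm_mul]
  exact mul_le_mul_of_nonneg_right hθ (norm_nonneg _)

/-- bounded symbol of sup norm at most one -/
structure Sym1 where
  φ : Tc → ℂ
  meas : AEStronglyMeasurable φ m
  bound : ∀ᵐ θ ∂m, ‖φ θ‖ ≤ 1

def Sym1.cj (S : Sym1) : Sym1 where
  φ := fun θ => conj (S.φ θ)
  meas := RCLike.continuous_conj.comp_aestronglyMeasurable S.meas
  bound := by filter_upwards [S.bound] with θ h; simpa using h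

/-- multiplication operator -/
def Sym1.M (S : Sym1) : L2 →L[ℂ] L2 :=
  LinearMap.mkContinuous
    { toFun := fun f => (memLp_mul_bdd S.meas S.bound (Lp.memLp f)).toLp _
      map_add' := by
        intro f g
        rw [← MemLp.toLp_add]
        apply MemLp.toLp_congr
        filter_upwards [Lp.coeFn_add f g] with θ h
        rw [h, Pi.add_apply, mul_add]; rfl
      map_smul' := by
        intro c f
        rw [RingHom.id_apply, ← MemLp.toLp_const_smul]
        apply MemLp.toLp_congr
        filter_upwards [Lp.coeFn_smul c f] with θ h
        simp only [h, Pi.smul_apply, smul_eq_mul]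
        ring } 1 (by
      intro f
      rw [one_mul]
      apply Lp.norm_le_norm_of_ae_le
      simp only [LinearMap.coe_mk, AddHom.coe_mk]
      filter_upwards [MemLp.coeFn_toLp (memLp_mul_bdd S.meas S.bound (Lp.memLp f)), S.bound] with θ h h2
      rw [h, norm_mul]
      exact mul_le_of_le_one_left (norm_nonneg _) h2)

lemma Sym1.coeFn_M (S : Sym1) (f : L2) : (S.M f : Tc → ℂ) =ᵐ[m] fun θ => S.φ θ * f θ :=
  MemLp.coeFn_toLp (memLp_mul_bdd S.meas S.bound (Lp.memLp f))

lemma Sym1.norm_M (S : Sym1) : ‖S.M‖ ≤ 1 := LinearMap.mkContinuous_norm_le _ zero_le_one _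

lemma Sym1.adj (S : Sym1) (f g : L2) : inner ℂ (S.cj.M f) g = inner ℂ f (S.M g) := by
  rw [L2.inner_def, L2.inner_def]
  apply integral_congr_ae
  filter_upwards [S.coeFn_M g, S.cj.coeFn_M f] with θ h1 h2
  rw [h1, h2]
  simp [Sym1.cj]
  ring

lemma Sym1.comm (S T : Sym1) (f : L2) : S.M (T.M f) = T.M (S.M f) := by
  apply Lp.ext
  filter_upwards [S.coeFn_M (T.M f), T.coeFn_M (S.M f), S.coeFn_M f, T.coeFn_M f] with θ h1 h2 h3 h4
  rw [h1, h2, h3, h4]; ring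

def eb (n : ℤ) : L2 := fourierLp 2 n

lemma coeFn_eb (n : ℤ) : (eb n : Tc → ℂ) =ᵐ[m] fun θ => fourier n θ := coeFn_fourierLp 2 n

def fB : HilbertBasis ℤ ℂ L2 := fourierBasis

lemma fB_coe (n : ℤ) : fB n = eb n := by
  unfold fB eb
  exact congrFun coe_fourierBasis n

lemma inner_eb (n : ℤ) (f : L2) : inner ℂ (eb n) f = fourierCoeff (f : Tc → ℂ) n := by
  rw [← fB_coe, ← fB.repr_apply_apply]
  exact fourierBasis_repr f n

lemma fourierCoeff_int (f : Tc → ℂ) (n : ℤ) : fourierCoeff f n = ∫ θ, fourier (-n) θ * f θ ∂m := rfl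

lemma inner_eb_M (S : Sym1) (n k : ℤ) :
    inner ℂ (eb n) (S.M (eb k)) = ∫ θ, fourier (k - n) θ * S.φ θ ∂m := by
  rw [inner_eb, fourierCoeff_int]
  apply integral_congr_ae
  filter_upwards [S.coeFn_M (eb k), coeFn_eb k] with θ h1 h2
  rw [h1, h2, sub_eq_neg_add, fourier_add]
  ring

lemma inner_eq_zero_of_supp {x y : L2} (h : ∀ n : ℤ, inner ℂ (eb n) x = 0 ∨ inner ℂ (eb n) y = 0) :
    inner ℂ x y = 0 := by
  rw [← fB.tsum_inner_mul_inner x y]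
  refine (tsum_congr fun n => ?_).trans tsum_zero
  rw [fB_coe]
  rcases h n with h | h
  · rw [← inner_conj_symm, h]; simp
  · simp [h]

lemma eq_zero_of_coef {x : L2} (h : ∀ n : ℤ, inner ℂ (eb n) x = 0) : x = 0 := by
  have := inner_eq_zero_of_supp (x := x) (y := x) (fun n => Or.inl (h n))
  exact inner_self_eq_zero.1 this

/-- the Hardy space as a submodule -/
def KH : Submodule ℂ L2 where
  carrier := {f | ∀ n : ℤ, n < 0 → inner ℂ (eb n) f = 0}
  add_mem' := by
    intro f g hf hg n hn
    rw [inner_add_right, hf n hn, hg n hn, add_zero]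
  zero_mem' := by intro n hn; simp
  smul_mem' := by
    intro c f hf n hn
    rw [inner_smul_right, hf n hn, mul_zero]

lemma mem_KH {f : L2} : f ∈ KH ↔ ∀ n : ℤ, n < 0 → inner ℂ (eb n) f = 0 := Iff.rfl

lemma mem_KH_iff_H2 {f : L2} : f ∈ KH ↔ f ∈ H2 := by
  rw [mem_KH]; simp only [H2, Set.mem_ofPred_eq, inner_eb]

lemma isClosed_KH : IsClosed (KH : Set L2) := by
  have : (KH : Set L2) = ⋂ n : ℤ, ⋂ _ : n < 0, {f | inner ℂ (eb n) f = 0} := by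
    ext f; simp [mem_KH]
  rw [this]
  refine isClosed_iInter fun n => isClosed_iInter fun _ => ?_
  exact isClosed_eq (by fun_prop) continuous_const

instance : CompleteSpace KH := isClosed_KH.completeSpace_coe

lemma inner_eb_eb (n k : ℤ) : inner ℂ (eb n) (eb k) = if n = k then (1 : ℂ) else 0 := by
  rw [← fB_coe, ← fB_coe]
  exact orthonormal_iff_ite.1 fB.orthonormal n k

lemma eb_mem {n : ℤ} (hn : 0 ≤ n) : eb n ∈ KH := by
  intro k hk
  rw [inner_eb_eb, if_neg (by omega)]

lemma mem_KH_perp {f : L2} : f ∈ KHᗮ ↔ ∀ n : ℤ, 0 ≤ n → inner ℂ (eb n) f = 0 := by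
  constructor
  · intro h n hn
    exact h _ (eb_mem hn)
  · intro h x hx
    apply inner_eq_zero_of_supp
    intro n
    by_cases hn : n < 0
    · exact Or.inl (hx n hn)
    · exact Or.inr (h n (by omega))

/-- an analytic symbol maps the Hardy space to itself -/
lemma Sym1.M_mem (S : Sym1) (hS : ∀ n : ℤ, 1 ≤ n → ∫ θ, fourier n θ * S.φ θ ∂m = 0) {f : L2}
    (hf : f ∈ KH) : S.M f ∈ KH := by
  intro n hn
  rw [← S.adj]
  apply inner_eq_zero_of_supp
  intro k
  by_cases hk : k < 0
  · exact Or.inr (hf k hk)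
  · left
    rw [← inner_conj_symm, S.adj, inner_eb_M, hS _ (by omega)]
    simp

theorem abstract_core {H : Type*} [NormedAddCommGroup H] [InnerProductSpace ℂ H] [CompleteSpace H]
    (K : Submodule ℂ H) [K.HasOrthogonalProjection] (A A' B B' : H →L[ℂ] H)
    (adjA : ∀ x y, inner ℂ (A' x) y = inner ℂ x (A y))
    (adjB : ∀ x y, inner ℂ (B' x) y = inner ℂ x (B y))
    (hA : ∀ x ∈ K, A x ∈ K) (hB : ∀ x ∈ K, B x ∈ K)
    (cA'B' : ∀ x, A' (B' x) = B' (A' x)) (cAB' : ∀ x, A (B' x) = B' (A x))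
    (cAA' : ∀ x, A (A' x) = A' (A x))
    (hsum : ∀ x, A' (A x) + B' (B x) = x) (hB'n : ‖B'‖ ≤ 1) (β : ℂ) (hβ : ‖β‖ < 1)
    (inj1 : ∀ R ∈ K, A' R ∈ Kᗮ → R = 0) (inj2 : ∀ h ∈ Kᗮ, A h ∈ K → h = 0)
    (inj3 : ∀ g, A g = 0 → g = 0)
    (D : Set H) (hDK : D ⊆ K) (hD : ∀ x ∈ K, (∀ q ∈ D, inner ℂ q x = 0) → x = 0)
    (g gp : H) (hg : g ∈ K) (hgp : gp ∈ K) (hG : B' g - A' gp ∈ Kᗮ)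
    (hyp : ∀ q ∈ D, ∃ s ∈ K, A' q - s ∈ Kᗮ ∧ ∃ X2 ∈ K, B' (s - conj β • B s) - A' X2 ∈ Kᗮ ∧
      inner ℂ (s - conj β • B s) g + inner ℂ X2 gp = 0) : g = 0 ∧ gp = 0 := by
  have hA'p : ∀ x ∈ Kᗮ, A' x ∈ Kᗮ := by
    intro x hx
    rw [Submodule.mem_orthogonal'] at hx ⊢
    intro y hy
    rw [adjA]; exact hx _ (hA _ hy)
  have hB'p : ∀ x ∈ Kᗮ, B' x ∈ Kᗮ := by
    intro x hx
    rw [Submodule.mem_orthogonal'] at hx ⊢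
    intro y hy
    rw [adjB]; exact hx _ (hB _ hy)
  have key : A g + B gp - β • gp = 0 := by
    apply hD _ (K.sub_mem (K.add_mem (hA _ hg) (hB _ hgp)) (K.smul_mem _ hgp))
    intro q hq
    obtain ⟨s, hs, hqs, X2, hX2, hX, h0⟩ := hyp q hq
    set t := K.starProjection (B' q) with ht
    have htK : t ∈ K := by rw [ht]; exact Submodule.starProjection_apply_mem K (B' q)
    have htp : B' q - t ∈ Kᗮ := Submodule.sub_starProjection_mem_orthogonal (B' q)
    have hqK := hDK hq
    have hX2eq : X2 = conj β • A s + t - conj β • q := by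
      rw [← sub_eq_zero]
      apply inj1
      · exact K.sub_mem hX2 (K.sub_mem (K.add_mem (K.smul_mem _ (hA _ hs)) htK) (K.smul_mem _ hqK))
      · have e : A' (X2 - (conj β • A s + t - conj β • q)) =
            -(B' (s - conj β • B s) - A' X2) - B' (A' q - s) + A' (B' q - t)
              + conj β • (A' q - s) := by
          have h1 := hsum s
          have h2 : B' (B s) = s - A' (A s) := eq_sub_of_add_eq' h1
          simp only [map_sub, map_add, map_smul, h2, cA'B']
          module
        rw [e]
        exact Kᗮ.add_mem (Kᗮ.add_mem (Kᗮ.sub_mem (Kᗮ.neg_mem hX) (hB'p _ hqs)) (hA'p _ htp))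
          (Kᗮ.smul_mem _ hqs)
    have z1 : inner ℂ (B s) g = inner ℂ (A s) gp := by
      have h3 := hG s hs
      rw [inner_sub_right, sub_eq_zero] at h3
      have e1 : inner ℂ s (B' g) = inner ℂ (B s) g := by
        rw [← inner_conj_symm, adjB, inner_conj_symm]
      have e2 : inner ℂ s (A' gp) = inner ℂ (A s) gp := by
        rw [← inner_conj_symm, adjA, inner_conj_symm]
      rw [← e1, ← e2, h3]
    have z2 : inner ℂ s g = inner ℂ q (A g) := by
      have := (Submodule.mem_orthogonal' _ _).1 hqs g hg
      rw [inner_sub_left, sub_eq_zero, adjA] at this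
      exact this.symm
    have z3 : inner ℂ t gp = inner ℂ q (B gp) := by
      have := (Submodule.mem_orthogonal' _ _).1 htp gp hgp
      rw [inner_sub_left, sub_eq_zero, adjB] at this
      exact this.symm
    rw [hX2eq] at h0
    simp only [inner_sub_left, inner_add_left, inner_smul_left, inner_sub_right, inner_add_right,
      inner_smul_right, z1, z2, z3, Complex.conj_conj] at h0 ⊢
    linear_combination h0
  set c := B' g - A' gp with hc
  have hAc : A c = β • B' gp - gp := by
    have h1 : A g = β • gp - B gp := by
      rw [← sub_eq_zero]; rw [← key]; abel
    have h2 := hsum gp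
    rw [hc, map_sub, cAB', cAA', h1, map_sub, map_smul]
    have h3 : B' (B gp) = gp - A' (A gp) := eq_sub_of_add_eq' h2
    rw [h3]
    abel
  have hT : ‖β • B'‖ < 1 := by
    rw [norm_smul]
    calc ‖β‖ * ‖B'‖ ≤ ‖β‖ * 1 := by gcongr
      _ < 1 := by simpa using hβ
  obtain ⟨U, hU⟩ := isUnit_one_sub_of_norm_lt_one hT
  set h := (↑U⁻¹ : H →L[ℂ] H) c with hh
  have hUh : h - β • B' h = c := by
    have : (U : H →L[ℂ] H) h = c := by
      rw [hh, ← mul_apply_eq_comp, Units.mul_inv]; rfl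
    rw [hU] at this
    simpa using this
  have contr : ∀ x : H, ‖x‖ ≤ ‖β • B' x‖ → x = 0 := by
    intro x hx
    by_contra hne
    have hpos : 0 < ‖x‖ := norm_pos_iff.2 hne
    have : ‖β • B' x‖ ≤ ‖β • B'‖ * ‖x‖ := (β • B').le_opNorm x
    nlinarith
  have hhp : h ∈ Kᗮ := by
    have : K.starProjection h = 0 := by
      apply contr
      set p := K.starProjection h with hp
      have h1 : h - p ∈ Kᗮ := Submodule.sub_starProjection_mem_orthogonal h
      have h2 : p - β • B' p ∈ Kᗮ := by
        have : p - β • B' p = c - ((h - p) - β • B' (h - p)) := by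
          rw [← hUh, map_sub]; module
        rw [this]
        exact Kᗮ.sub_mem hG (Kᗮ.sub_mem h1 (Kᗮ.smul_mem _ (hB'p _ h1)))
      have h3 : inner ℂ p (p - β • B' p) = 0 := h2 p (Submodule.starProjection_apply_mem K h)
      rw [inner_sub_right, sub_eq_zero] at h3
      have h4 : ‖p‖ * ‖p‖ ≤ ‖p‖ * ‖β • B' p‖ := by
        have := norm_inner_le_norm (𝕜 := ℂ) p (β • B' p)
        rw [← h3, inner_self_eq_norm_sq_to_K] at this
        simpa [sq] using this
      by_cases hp0 : ‖p‖ = 0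
      · rw [hp0]; positivity
      · exact le_of_mul_le_mul_left h4 (lt_of_le_of_ne (norm_nonneg _) (Ne.symm hp0))
    have h1 := Submodule.sub_starProjection_mem_orthogonal (K := K) h
    rwa [this, sub_zero] at h1
  have hAh : A h = -gp := by
    have : A h + gp = 0 := by
      apply contr
      have : A h + gp = β • B' (A h + gp) := by
        have e : A h - β • B' (A h) = β • B' gp - gp := by
          rw [← hAc, ← hUh, map_sub, map_smul, cAB']
        rw [map_add, smul_add]
        have := sub_eq_iff_eq_add.1 e
        nth_rewrite 1 [this]
        abel
      exact (congrArg norm this).le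
    exact eq_neg_of_add_eq_zero_left this
  have h0 : h = 0 := inj2 h hhp (by rw [hAh]; exact K.neg_mem hgp)
  have hgp0 : gp = 0 := by
    rw [h0, map_zero] at hAh
    simpa using hAh.symm
  refine ⟨?_, hgp0⟩
  apply inj3
  simpa [hgp0] using key

/-- Herglotz kernel -/
def hk (z : ℂ) (θ : Tc) : ℂ := (bd θ + z) / (bd θ - z)

def Qk (z : ℂ) (θ : Tc) : ℝ := (hk z θ).re

lemma bd_sub_ne {z : ℂ} (hz : z ∈ uDisc) (θ : Tc) : bd θ - z ≠ 0 := by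
  intro h
  rw [sub_eq_zero] at h
  have h1 := norm_bd θ
  rw [h] at h1
  simp [h1] at hz

lemma cont_hk {z : ℂ} (hz : z ∈ uDisc) : Continuous (hk z) := by
  unfold hk
  exact Continuous.div (by fun_prop) (by fun_prop) (bd_sub_ne hz)

lemma hk_bound {z : ℂ} (hz : z ∈ uDisc) (θ : Tc) : ‖hk z θ‖ ≤ 2 / (1 - ‖z‖) := by
  have hz' : ‖z‖ < 1 := by simpa using hz
  unfold hk
  rw [norm_div]
  have h1 : ‖bd θ + z‖ ≤ 2 := (norm_add_le _ _).trans (by rw [norm_bd]; linarith)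
  have h2 : 1 - ‖z‖ ≤ ‖bd θ - z‖ := by
    have := norm_sub_norm_le (bd θ) z
    rwa [norm_bd] at this
  exact div_le_div₀ (by norm_num) h1 (by linarith) h2

lemma int_hk {z : ℂ} (hz : z ∈ uDisc) {v : Tc → ℂ} (hv : Integrable v m) :
    Integrable (fun θ => hk z θ * v θ) m :=
  hv.bdd_mul (cont_hk hz).aestronglyMeasurable (Eventually.of_forall (hk_bound hz))

lemma cont_Qk {z : ℂ} (hz : z ∈ uDisc) : Continuous (Qk z) :=
  Complex.continuous_re.comp (cont_hk hz)

lemma Qk_eq (z : ℂ) (θ : Tc) : Qk z θ = (1 - ‖z‖ ^ 2) / ‖bd θ - z‖ ^ 2 := by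
  have := congrFun (poissonKernel_eq_re_herglotzRieszKernel (c := 0) (w := z)) (bd θ)
  simp only [poissonKernel_def, herglotzRieszKernel_def, Function.comp_apply, sub_zero, norm_bd] at this
  rw [Qk, hk, ← this]; simp

lemma Qk_nonneg {z : ℂ} (hz : z ∈ uDisc) (θ : Tc) : 0 ≤ Qk z θ := by
  have hz' : ‖z‖ < 1 := by simpa using hz
  rw [Qk_eq]
  have : 0 ≤ 1 - ‖z‖ ^ 2 := by nlinarith [norm_nonneg z]
  positivity

lemma Qk_le {z : ℂ} (hz : z ∈ uDisc) (θ : Tc) : Qk z θ ≤ 2 / (1 - ‖z‖) :=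
  (Complex.re_le_norm _).trans (hk_bound hz θ)

lemma int_Qk {z : ℂ} (hz : z ∈ uDisc) {v : Tc → ℝ} (hv : Integrable v m) :
    Integrable (fun θ => Qk z θ * v θ) m := by
  refine hv.bdd_mul (cont_Qk hz).aestronglyMeasurable (c := 2 / (1 - ‖z‖)) (Eventually.of_forall fun θ => ?_)
  rw [Real.norm_eq_abs, abs_of_nonneg (Qk_nonneg hz θ)]
  exact Qk_le hz θ

lemma Qk_pow {z : ℂ} (hz : z ∈ uDisc) (n : ℕ) : ∫ θ, (Qk z θ : ℂ) * bd θ ^ n ∂m = z ^ n := by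
  have h : DiffContOnCl ℂ (fun z : ℂ => z ^ n) (ball 0 1) :=
    Differentiable.diffContOnCl (by fun_prop)
  have := h.circleAverage_re_herglotzRieszKernel_smul hz
  rw [circleAvg_eq] at this
  simpa [Qk, hk, herglotzRieszKernel_def] using this

lemma Qk_one {z : ℂ} (hz : z ∈ uDisc) : ∫ θ, Qk z θ ∂m = 1 := by
  have := Qk_pow hz 0
  simp only [pow_zero, mul_one] at this
  have h2 : ∫ θ, (Qk z θ : ℂ) ∂m = ((∫ θ, Qk z θ ∂m : ℝ) : ℂ) := integral_ofReal
  rw [h2] at this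
  exact_mod_cast this

lemma conj_bd (θ : Tc) : conj (bd θ) = (bd θ)⁻¹ := by
  rw [Complex.inv_def, Complex.normSq_eq_norm_sq, norm_bd]; simp

lemma Qk_sym (r : ℝ) (θ t : Tc) : Qk ((r : ℂ) * bd θ) t = Qk ((r : ℂ) * bd t) θ := by
  rw [Qk_eq, Qk_eq]
  have h : ‖bd t - r * bd θ‖ = ‖bd θ - r * bd t‖ := by
    have : bd t - r * bd θ = (bd t * bd θ) * conj (bd θ - r * bd t) := by
      simp only [map_sub, map_mul, conj_bd, Complex.conj_ofReal]
      field_simp [bd_ne]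
    rw [this, norm_mul, norm_mul, RCLike.norm_conj, norm_bd, norm_bd, one_mul, one_mul]
  rw [h]; simp [norm_bd]

/-- Poisson integral at radius r -/
def Pr (r : ℝ) (v : Tc → ℂ) (θ : Tc) : ℂ := ∫ t, (Qk ((r : ℂ) * bd θ) t : ℂ) * v t ∂m

lemma int_QkC {r : ℝ} (h0 : 0 ≤ r) (h1 : r < 1) {v : Tc → ℂ} (hv : Integrable v m) (θ : Tc) :
    Integrable (fun t => (Qk ((r : ℂ) * bd θ) t : ℂ) * v t) m := by
  refine hv.bdd_mul (c := 2 / (1 - ‖(r : ℂ) * bd θ‖))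
    (Complex.continuous_ofReal.comp (cont_Qk (mul_bd_mem h0 h1 θ))).aestronglyMeasurable
    (Eventually.of_forall fun t => ?_)
  rw [Complex.norm_real, Real.norm_eq_abs, abs_of_nonneg (Qk_nonneg (mul_bd_mem h0 h1 θ) t)]
  exact Qk_le (mul_bd_mem h0 h1 θ) t

lemma int_QkProd {r : ℝ} (h0 : 0 ≤ r) (h1 : r < 1) {v : Tc → ℂ} (hv : Integrable v m) :
    Integrable (fun p : Tc × Tc => (Qk ((r : ℂ) * bd p.1) p.2 : ℂ) * v p.2) (m.prod m) := by
  refine (hv.comp_snd m).bdd_mul (c := 2 / (1 - r)) ?_ (Eventually.of_forall fun p => ?_)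
  · apply Continuous.aestronglyMeasurable
    apply Complex.continuous_ofReal.comp
    unfold Qk hk
    apply Complex.continuous_re.comp
    refine Continuous.div (by fun_prop) (by fun_prop) ?_
    intro p
    exact bd_sub_ne (mul_bd_mem h0 h1 p.1) p.2
  · rw [Complex.norm_real, Real.norm_eq_abs, abs_of_nonneg (Qk_nonneg (mul_bd_mem h0 h1 p.1) p.2)]
    have := Qk_le (mul_bd_mem h0 h1 p.1) p.2
    simpa [norm_bd, abs_of_nonneg h0] using this

lemma int_Pr {r : ℝ} (h0 : 0 ≤ r) (h1 : r < 1) {v : Tc → ℂ} (hv : Integrable v m) : Integrable (Pr r v) m :=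
  (int_QkProd h0 h1 hv).integral_prod_left

lemma norm_Pr_le {r : ℝ} (h0 : 0 ≤ r) (h1 : r < 1) {v : Tc → ℂ} (hv : Integrable v m) : ∫ θ, ‖Pr r v θ‖ ∂m ≤ ∫ θ, ‖v θ‖ ∂m := by
  have hp := int_QkProd h0 h1 hv
  have e1 : ∫ θ, ‖Pr r v θ‖ ∂m ≤ ∫ θ, ∫ t, ‖(Qk ((r : ℂ) * bd θ) t : ℂ) * v t‖ ∂m ∂m :=
    integral_mono (int_Pr h0 h1 hv).norm hp.norm.integral_prod_left
      (fun θ => norm_integral_le_integral_norm _)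
  refine e1.trans (le_of_eq ?_)
  rw [integral_integral_swap (f := fun θ t => ‖(Qk ((r : ℂ) * bd θ) t : ℂ) * v t‖) hp.norm]
  congr 1
  ext t
  simp_rw [norm_mul, integral_mul_const, Complex.norm_real, Real.norm_eq_abs,
    fun θ => abs_of_nonneg (Qk_nonneg (mul_bd_mem h0 h1 θ) t), Qk_sym r _ t,
    Qk_one (mul_bd_mem h0 h1 t), one_mul]

lemma Pr_add {r : ℝ} (h0 : 0 ≤ r) (h1 : r < 1) {v w : Tc → ℂ} (hv : Integrable v m) (hw : Integrable w m) (θ : Tc) :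
    Pr r (v + w) θ = Pr r v θ + Pr r w θ := by
  unfold Pr
  rw [← integral_add (int_QkC h0 h1 hv θ) (int_QkC h0 h1 hw θ)]
  simp [mul_add]

lemma Pr_smul {r : ℝ} (c : ℂ) (v : Tc → ℂ) (θ : Tc) : Pr r (c • v) θ = c * Pr r v θ := by
  unfold Pr
  rw [← integral_const_mul]
  congr 1; ext t; simp; ring

lemma Pr_congr {r : ℝ} {v w : Tc → ℂ} (h : v =ᵐ[m] w) : Pr r v = Pr r w := by
  ext θ
  apply integral_congr_ae
  filter_upwards [h] with t ht
  rw [ht]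

lemma Pr_fourier {r : ℝ} (h0 : 0 ≤ r) (h1 : r < 1) (n : ℤ) (θ : Tc) : Pr r (fun t => fourier n t) θ = (r : ℂ) ^ n.natAbs * fourier n θ := by
  unfold Pr
  rcases Int.eq_nat_or_neg n with ⟨k, rfl | rfl⟩
  · simp_rw [fourier_eq_bd, zpow_natCast, Qk_pow (mul_bd_mem h0 h1 θ) k]
    simp [mul_pow]
  · have h := congrArg (starRingEnd ℂ) (Qk_pow (mul_bd_mem h0 h1 θ) k)
    rw [← integral_conj] at h
    simp_rw [fourier_eq_bd]
    simp only [map_mul, map_pow, conj_bd, Complex.conj_ofReal] at h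
    simpa [mul_pow] using h


/-- L1 distance between Poisson integral and function -/
def dd (n : ℕ) (v : Tc → ℂ) : ℝ := ∫ θ, ‖Pr (rr n) v θ - v θ‖ ∂m

lemma dd_nonneg (n : ℕ) (v : Tc → ℂ) : 0 ≤ dd n v := integral_nonneg fun _ => norm_nonneg _

lemma dd_add (n : ℕ) {v w : Tc → ℂ} (hv : Integrable v m) (hw : Integrable w m) :
    dd n (v + w) ≤ dd n v + dd n w := by
  have pv := int_Pr (rr_pos n).le (rr_lt n) hv
  have pw := int_Pr (rr_pos n).le (rr_lt n) hw
  unfold dd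
  refine le_trans ?_ (le_of_eq (integral_add (pv.sub hv).norm (pw.sub hw).norm))
  refine integral_mono ((int_Pr (rr_pos n).le (rr_lt n) (hv.add hw)).sub (hv.add hw)).norm
    ((pv.sub hv).norm.add (pw.sub hw).norm) fun θ => ?_
  simp only [Pr_add (rr_pos n).le (rr_lt n) hv hw, Pi.add_apply]
  refine le_trans (le_of_eq ?_) (norm_add_le _ _)
  congr 1; ring

lemma dd_le (n : ℕ) {v : Tc → ℂ} (hv : Integrable v m) : dd n v ≤ 2 * ∫ θ, ‖v θ‖ ∂m := by
  have pv := int_Pr (rr_pos n).le (rr_lt n) hv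
  unfold dd
  calc ∫ θ, ‖Pr (rr n) v θ - v θ‖ ∂m ≤ ∫ θ, (‖Pr (rr n) v θ‖ + ‖v θ‖) ∂m :=
        integral_mono (pv.sub hv).norm (pv.norm.add hv.norm) fun θ => norm_sub_le _ _
    _ = ∫ θ, ‖Pr (rr n) v θ‖ ∂m + ∫ θ, ‖v θ‖ ∂m := integral_add pv.norm hv.norm
    _ ≤ 2 * ∫ θ, ‖v θ‖ ∂m := by
        have := norm_Pr_le (rr_pos n).le (rr_lt n) hv
        linarith

lemma dd_congr (n : ℕ) {v w : Tc → ℂ} (h : v =ᵐ[m] w) : dd n v = dd n w := by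
  unfold dd
  rw [Pr_congr h]
  apply integral_congr_ae
  filter_upwards [h] with t ht
  rw [ht]

lemma dd_smul (n : ℕ) (c : ℂ) (v : Tc → ℂ) : dd n (c • v) = ‖c‖ * dd n v := by
  unfold dd
  rw [← integral_const_mul]
  congr 1; ext θ
  rw [Pr_smul, ← norm_mul]
  congr 1; simp; ring

/-- Fourier monomials in L1 -/
def e1 (n : ℤ) : Lp ℂ 1 m := fourierLp 1 n

lemma coeFn_e1 (n : ℤ) : (e1 n : Tc → ℂ) =ᵐ[m] fun θ => fourier n θ := coeFn_fourierLp 1 n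

lemma e1_dense : (Submodule.span ℂ (Set.range e1)).topologicalClosure = ⊤ :=
  span_fourierLp_closure_eq_top (T := 2 * Real.pi) (p := 1) (by simp)

lemma dd_tendsto_span (y : Lp ℂ 1 m)
    (hy : y ∈ Submodule.span ℂ (Set.range e1)) :
    Tendsto (fun n => dd n y) atTop (nhds 0) := by
  induction hy using Submodule.span_induction with
  | mem x hx =>
    obtain ⟨k, rfl⟩ := hx
    have e : ∀ n, dd n (e1 k) = 1 - rr n ^ k.natAbs := by
      intro n
      rw [dd_congr n (coeFn_e1 k)]
      unfold dd
      have : ∀ θ : Tc, ‖Pr (rr n) (fun t => fourier k t) θ - fourier k θ‖ = 1 - rr n ^ k.natAbs := by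
        intro θ
        rw [Pr_fourier (rr_pos n).le (rr_lt n)]
        have e2 : ((rr n : ℂ) ^ k.natAbs * fourier k θ - fourier k θ)
            = (((rr n ^ k.natAbs - 1 : ℝ)) : ℂ) * fourier k θ := by push_cast; ring
        rw [e2, norm_mul, norm_fourier_apply, mul_one, Complex.norm_real, Real.norm_eq_abs,
          abs_of_nonpos (sub_nonpos.2 (pow_le_one₀ (rr_pos n).le (rr_lt n).le))]
        ring
      simp_rw [this]; simp
    simp_rw [e]
    have := (rr_tendsto1.pow k.natAbs).const_sub 1
    simpa using this
  | zero =>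
    have : ∀ n, dd n (0 : Lp ℂ 1 m) = 0 := by
      intro n
      rw [dd_congr n (Lp.coeFn_zero ℂ 1 m)]
      simp [dd, Pr]
    simp_rw [this]; exact tendsto_const_nhds
  | add x y _ _ hx hy =>
    refine squeeze_zero (fun n => dd_nonneg n _) (fun n => ?_) (by simpa using hx.add hy)
    rw [dd_congr n (Lp.coeFn_add x y)]
    exact dd_add n (L1.integrable_coeFn x) (L1.integrable_coeFn y)
  | smul c x _ hx =>
    have := hx.const_mul ‖c‖
    rw [mul_zero] at this
    refine this.congr fun n => ?_
    rw [dd_congr n (Lp.coeFn_smul c x), dd_smul]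

lemma dd_tendsto {v : Tc → ℂ} (hv : Integrable v m) : Tendsto (fun n => dd n v) atTop (nhds 0) := by
  rw [Metric.tendsto_atTop]
  intro ε hε
  have hv1 : MemLp v 1 m := memLp_one_iff_integrable.2 hv
  have hd : (hv1.toLp v) ∈ closure (Submodule.span ℂ
      (Set.range e1) : Set (Lp ℂ 1 m)) := by
    rw [← Submodule.topologicalClosure_coe, e1_dense]; trivial
  obtain ⟨y, hy, hdist⟩ := Metric.mem_closure_iff.1 hd (ε / 4) (by positivity)
  have hyt := dd_tendsto_span y hy
  obtain ⟨N, hN⟩ := Metric.tendsto_atTop.1 hyt (ε / 4) (by positivity)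
  refine ⟨N, fun n hn => ?_⟩
  have h1 := hN n hn
  rw [Real.dist_eq, sub_zero, abs_of_nonneg (dd_nonneg _ _)] at h1 ⊢
  have hyi : Integrable y m := L1.integrable_coeFn y
  have h2 : dd n v ≤ dd n y + dd n (v - y) := by
    have := dd_add n hyi (hv.sub hyi)
    simpa using this
  have h3 := dd_le n (hv.sub hyi)
  have h4 : ∫ θ, ‖(v - y) θ‖ ∂m < ε / 4 := by
    refine lt_of_le_of_lt (le_of_eq ?_) hdist
    rw [dist_eq_norm, L1.norm_eq_integral_norm]
    apply integral_congr_ae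
    filter_upwards [Lp.coeFn_sub (hv1.toLp v) y, hv1.coeFn_toLp] with θ h5 h6
    rw [h5, Pi.sub_apply, Pi.sub_apply, h6]
  linarith

/-- exponential of Herglotz integral -/
def Ex (u : Tc → ℝ) (z : ℂ) : ℂ := Complex.exp (∫ θ, hk z θ * (u θ : ℂ) ∂m)

lemma norm_Ex {u : Tc → ℝ} (hu : Integrable u m) {z : ℂ} (hz : z ∈ uDisc) :
    ‖Ex u z‖ = Real.exp (∫ θ, Qk z θ * u θ ∂m) := by
  rw [Ex, Complex.norm_exp]
  congr 1
  have hc : Integrable (fun θ => ((u θ : ℝ) : ℂ)) m := hu.ofReal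
  have h := int_hk hz hc
  have h2 : ∫ θ, (hk z θ * (u θ : ℂ)).re ∂m = (∫ θ, hk z θ * (u θ : ℂ) ∂m).re := integral_re h
  rw [← h2]
  congr 1
  ext θ
  simp [Qk]

lemma Pr_ofReal (r : ℝ) (u : Tc → ℝ) (θ : Tc) :
    Pr r (fun t => (u t : ℂ)) θ = ((∫ t, Qk ((r : ℂ) * bd θ) t * u t ∂m : ℝ) : ℂ) := by
  unfold Pr
  have h2 : ∫ t, ((Qk ((r : ℂ) * bd θ) t * u t : ℝ) : ℂ) ∂m
    = ((∫ t, Qk ((r : ℂ) * bd θ) t * u t ∂m : ℝ) : ℂ) := integral_ofReal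
  rw [← h2]
  simp

lemma outer_nonpos {u : Tc → ℝ} (hu : Integrable u m) {a : ℂ → ℂ} {as' : Tc → ℂ}
    (ha : ∀ z ∈ uDisc, ‖a z‖ = ‖Ex u z‖) (hbd : IsBdry a as') (hle : ∀ᵐ θ ∂m, ‖as' θ‖ ≤ 1) :
    ∀ᵐ θ ∂m, u θ ≤ 0 := by
  have hv : Integrable (fun θ => (u θ : ℂ)) m := hu.ofReal
  have hd := dd_tendsto hv
  have hm : TendstoInMeasure m (fun n => Pr (rr n) (fun θ => (u θ : ℂ))) atTop (fun θ => (u θ : ℂ)) := by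
    apply tendstoInMeasure_of_tendsto_eLpNorm (p := 1) one_ne_zero
    · intro n; exact (int_Pr (rr_pos n).le (rr_lt n) hv).1
    · exact hv.1
    · have : ∀ n, eLpNorm (Pr (rr n) (fun θ => (u θ : ℂ)) - fun θ => (u θ : ℂ)) 1 m
          = ENNReal.ofReal (dd n (fun θ => (u θ : ℂ))) := by
        intro n
        have h9 := ofReal_integral_norm_eq_lintegral_enorm ((int_Pr (rr_pos n).le (rr_lt n) hv).sub hv)
        rw [eLpNorm_one_eq_lintegral_enorm]
        exact h9.symm
      simp_rw [this]
      have := ENNReal.tendsto_ofReal hd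
      simpa using this
  obtain ⟨ns, hns, hae⟩ := hm.exists_seq_tendsto_ae
  filter_upwards [hae, hbd.seq, hle] with θ h1 h2 h3
  have h4 : Tendsto (fun i => ‖a ((rr (ns i) : ℂ) * bd θ)‖) atTop (nhds ‖as' θ‖) :=
    (h2.comp hns.tendsto_atTop).norm
  have h5 : Tendsto (fun i => ‖a ((rr (ns i) : ℂ) * bd θ)‖) atTop (nhds (Real.exp (u θ))) := by
    have h6 : Tendsto (fun i => (Pr (rr (ns i)) (fun θ => (u θ : ℂ)) θ).re) atTop (nhds (u θ)) := by
      have := (Complex.continuous_re.tendsto _).comp h1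
      simpa [Function.comp_def] using this
    have h7 := (Real.continuous_exp.tendsto _).comp h6
    refine h7.congr fun i => ?_
    have hz := mul_bd_mem (rr_pos (ns i)).le (rr_lt (ns i)) θ
    rw [ha _ hz, norm_Ex hu hz, Function.comp_apply, Pr_ofReal, Complex.ofReal_re]
  have h8 := tendsto_nhds_unique h4 h5
  rw [h8] at h3
  exact Real.exp_le_one_iff.1 h3

lemma bd_injective : Function.Injective bd := by
  intro x y h
  have : Function.Injective (@AddCircle.toCircle (2 * Real.pi)) :=
    AddCircle.injective_toCircle (by positivity)
  exact this (Subtype.ext h)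

lemma arg_bd (θ : Tc) : ((Complex.arg (bd θ) : ℝ) : Tc) = θ := by
  apply bd_injective
  rw [bd_coe, circleMap]
  have := Complex.norm_mul_exp_arg_mul_I (bd θ)
  rw [norm_bd] at this
  simpa using this

lemma hol_Ex {u : Tc → ℝ} (hu : Integrable u m) : HolDisc (Ex u) := by
  intro z hz
  apply DifferentiableAt.differentiableWithinAt
  unfold Ex
  apply DifferentiableAt.cexp
  let f : ℂ → ℂ := fun ζ => (u ((Complex.arg ζ : ℝ) : Tc) : ℂ)
  have hf : CircleIntegrable f 0 1 := by
    unfold CircleIntegrable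
    have e : (fun x : ℝ => f (circleMap 0 1 x)) = fun x : ℝ => (u (x : Tc) : ℂ) := by
      ext x
      simp only [f]
      rw [← bd_coe, arg_bd]
    rw [e, intervalIntegrable_iff, Set.uIoc_of_le (by positivity)]
    have h1 : Integrable (fun θ : Tc => (u θ : ℂ)) volume := by
      rw [AddCircle.volume_eq_smul_haarAddCircle]
      exact (hu.ofReal (𝕜 := ℂ)).smul_measure ENNReal.ofReal_ne_top
    have h2 := (AddCircle.measurePreserving_mk (2 * Real.pi) 0).integrable_comp_of_integrable h1
    rw [zero_add] at h2
    exact h2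
  have := (hasDerivAt_circleAverage_herglotzRieszKernel_smul hf hz).differentiableAt
  refine this.congr_of_eventuallyEq (Eventually.of_forall fun w => ?_)
  simp only [circleAvg_eq, f]
  simp [arg_bd, hk, herglotzRieszKernel_def]

lemma Ex_mul {u v : Tc → ℝ} (hu : Integrable u m) (hv : Integrable v m) {z : ℂ} (hz : z ∈ uDisc) :
    Ex u z * Ex v z = Ex (u + v) z := by
  unfold Ex
  have hc : Integrable (fun θ => ((u θ : ℝ) : ℂ)) m := hu.ofReal
  have hd : Integrable (fun θ => ((v θ : ℝ) : ℂ)) m := hv.ofReal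
  rw [← Complex.exp_add, ← integral_add (int_hk hz hc) (int_hk hz hd)]
  congr 2
  ext θ
  simp [mul_add]

lemma norm_Ex_le {u : Tc → ℝ} (hu : Integrable u m) {C : ℝ} (h : ∀ᵐ θ ∂m, u θ ≤ C) {z : ℂ}
    (hz : z ∈ uDisc) : ‖Ex u z‖ ≤ Real.exp C := by
  rw [norm_Ex hu hz]
  apply Real.exp_le_exp.2
  calc ∫ θ, Qk z θ * u θ ∂m ≤ ∫ θ, Qk z θ * C ∂m := by
        apply integral_mono_ae (int_Qk hz hu) (int_Qk hz (integrable_const C))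
        filter_upwards [h] with θ hθ
        exact mul_le_mul_of_nonneg_left hθ (Qk_nonneg hz θ)
    _ = C := by rw [integral_mul_const, Qk_one hz, one_mul]

lemma Ex_zero (u : Tc → ℝ) : Ex u 0 = Complex.exp ((∫ θ, u θ ∂m : ℝ) : ℂ) := by
  have h2 : ∫ t, (u t : ℂ) ∂m = ((∫ t, u t ∂m : ℝ) : ℂ) := integral_ofReal
  rw [Ex, ← h2]
  congr 2
  ext θ
  simp [hk, bd_ne]

/-- functions with complementary Fourier supports have zero pairing -/
lemma int_mul_zero {x y : Tc → ℂ} (hx : MemLp x 2 m) (hy : MemLp y 2 m)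
    (h1 : ∀ j : ℤ, 1 ≤ j → ∫ θ, fourier j θ * x θ ∂m = 0)
    (h2 : ∀ j : ℤ, 0 ≤ j → ∫ θ, fourier j θ * y θ ∂m = 0) : ∫ θ, x θ * y θ ∂m = 0 := by
  have hcy : MemLp (fun θ => conj (y θ)) 2 m := hy.star
  have key : inner ℂ (hcy.toLp _) (hx.toLp x) = 0 := by
    apply inner_eq_zero_of_supp
    intro j
    by_cases hj : j < 0
    · right
      rw [inner_eb, fourierCoeff_int, ← h1 (-j) (by omega)]
      apply integral_congr_ae
      filter_upwards [hx.coeFn_toLp] with θ h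
      rw [h]
    · left
      rw [inner_eb, fourierCoeff_int]
      have := congrArg (starRingEnd ℂ) (h2 j (by omega))
      rw [← integral_conj, map_zero] at this
      rw [← this]
      apply integral_congr_ae
      filter_upwards [hcy.coeFn_toLp] with θ h
      rw [h, fourier_neg, map_mul]
  rw [L2.inner_def] at key
  rw [← key]
  apply integral_congr_ae
  filter_upwards [hcy.coeFn_toLp, hx.coeFn_toLp] with θ h h'
  rw [h, h']
  simp

lemma cs_int {x y : Tc → ℂ} (hx : MemLp x 2 m) (hy : MemLp y 2 m) :
    ‖∫ θ, x θ * y θ ∂m‖ ^ 2 ≤ (∫ θ, ‖x θ‖ ^ 2 ∂m) * (∫ θ, ‖y θ‖ ^ 2 ∂m) := by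
  have hcy : MemLp (fun θ => conj (y θ)) 2 m := hy.star
  have e : ∫ θ, x θ * y θ ∂m = inner ℂ (hcy.toLp _) (hx.toLp x) := by
    rw [L2.inner_def]
    apply integral_congr_ae
    filter_upwards [hcy.coeFn_toLp, hx.coeFn_toLp] with θ h h'
    rw [h, h']
    simp
  have nn : ∀ f : L2, ‖f‖ ^ 2 = ∫ θ, ‖f θ‖ ^ 2 ∂m := by
    intro f
    have h1 : ((‖f‖ ^ 2 : ℝ) : ℂ) = inner ℂ f f := by
      rw [inner_self_eq_norm_sq_to_K]; simp
    rw [L2.inner_def] at h1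
    have h2 : ∫ θ, inner ℂ (f θ) (f θ) ∂m = ((∫ θ, ‖f θ‖ ^ 2 ∂m : ℝ) : ℂ) := by
      have h3 : ∫ θ, ((‖f θ‖ ^ 2 : ℝ) : ℂ) ∂m = ((∫ θ, ‖f θ‖ ^ 2 ∂m : ℝ) : ℂ) := integral_ofReal
      rw [← h3]
      congr 1; ext θ
      rw [inner_self_eq_norm_sq_to_K]; simp
    rw [h2] at h1
    exact_mod_cast h1
  have nx : ‖hx.toLp x‖ ^ 2 = ∫ θ, ‖x θ‖ ^ 2 ∂m := by
    rw [nn]; apply integral_congr_ae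
    filter_upwards [hx.coeFn_toLp] with θ h
    rw [h]
  have ny : ‖hcy.toLp _‖ ^ 2 = ∫ θ, ‖y θ‖ ^ 2 ∂m := by
    rw [nn]; apply integral_congr_ae
    filter_upwards [hcy.coeFn_toLp] with θ h
    rw [h, RCLike.norm_conj]
  rw [e, ← nx, ← ny, ← mul_pow]
  exact pow_le_pow_left₀ (norm_nonneg _) ((norm_inner_le_norm _ _).trans_eq (mul_comm _ _)) 2

lemma outer_step {a φ : ℂ → ℂ} {as' h : Tc → ℂ} {C : ℝ} (ha : HolDisc a) (hφ : HolDisc φ)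
    (hC : ∀ z ∈ uDisc, ‖φ z‖ ≤ C) (ha1 : ∀ z ∈ uDisc, ‖a z‖ ≤ 1)
    (hψ : ∀ z ∈ uDisc, ‖a z * φ z‖ ≤ 1) (hbd : IsBdry a as')
    (hh : MemLp h 2 m) (n : ℤ)
    (hz : ∀ j : ℤ, n ≤ j → ∫ θ, fourier j θ * (as' θ * h θ) ∂m = 0) :
    ‖∫ θ, fourier n θ * h θ ∂m‖ ^ 2 ≤ (2 - 2 * (a 0 * φ 0).re) * ∫ θ, ‖h θ‖ ^ 2 ∂m := by
  have hle := hbd.norm_le ha1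
  have hsm := hbd.aesm ha
  have hahm : MemLp (fun θ => as' θ * h θ) 2 m := memLp_mul_bdd hsm hle hh
  have hfn : ∀ {k : Tc → ℂ}, MemLp k 2 m → MemLp (fun θ => fourier n θ * k θ) 2 m := by
    intro k hk
    exact memLp_mul_bdd (map_continuous (fourier n)).aestronglyMeasurable (C := 1)
      (Eventually.of_forall fun θ => (norm_fourier_apply n θ).le) hk
  have hy := hfn hahm
  have hnh := hfn hh
  have hhol : HolDisc (fun z => a z * φ z) := ha.mul hφ
  have hC0 : 0 ≤ C := (norm_nonneg _).trans (hC 0 (by simp))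
  have hdisc := fun i θ => mul_bd_mem (rr_pos i).le (rr_lt i) θ
  -- vanishing
  have h1 : ∀ i, ∫ θ, φ ((rr i : ℂ) * bd θ) * (fourier n θ * (as' θ * h θ)) ∂m = 0 := by
    intro i
    apply int_mul_zero _ hy
    · intro j hj
      exact mean_fourier hφ (rr_pos i) (rr_lt i) hj
    · intro j hj
      rw [← hz (n + j) (by omega)]
      congr 1; ext θ
      rw [fourier_eq_bd, fourier_eq_bd, fourier_eq_bd, zpow_add₀ (bd_ne θ)]; ring
    · exact MemLp.of_bound (cont_dil hφ (rr_pos i).le (rr_lt i)).aestronglyMeasurable C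
        (Eventually.of_forall fun θ => hC _ (hdisc i θ))
  have hmul : ∀ i, MemLp (fun θ => (a ((rr i : ℂ) * bd θ) * φ ((rr i : ℂ) * bd θ)) * (fourier n θ * h θ)) 2 m :=
    fun i => memLp_mul_bdd (cont_dil hhol (rr_pos i).le (rr_lt i)).aestronglyMeasurable (C := 1)
      (Eventually.of_forall fun θ => hψ _ (hdisc i θ)) hnh
  have hmul2 : ∀ i, MemLp (fun θ => φ ((rr i : ℂ) * bd θ) * (fourier n θ * (as' θ * h θ))) 2 m :=
    fun i => memLp_mul_bdd (cont_dil hφ (rr_pos i).le (rr_lt i)).aestronglyMeasurable (C := C)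
      (Eventually.of_forall fun θ => hC _ (hdisc i θ)) hy
  have h2 : Tendsto (fun i => ∫ θ, (a ((rr i : ℂ) * bd θ) * φ ((rr i : ℂ) * bd θ)) * (fourier n θ * h θ) ∂m)
      atTop (nhds 0) := by
    have h3 : Tendsto (fun i => ∫ θ, ((a ((rr i : ℂ) * bd θ) * φ ((rr i : ℂ) * bd θ)) * (fourier n θ * h θ)
        - φ ((rr i : ℂ) * bd θ) * (fourier n θ * (as' θ * h θ))) ∂m) atTop (nhds (∫ _θ, (0:ℂ) ∂m)) := by
      apply tendsto_integral_of_dominated_convergence (fun θ => 2 * C * ‖h θ‖)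
      · intro i
        exact ((hmul i).sub (hmul2 i)).aestronglyMeasurable
      · exact ((hh.integrable (by norm_num)).norm).const_mul _
      · intro i
        filter_upwards [hle] with θ hθ
        have e : (a ((rr i : ℂ) * bd θ) * φ ((rr i : ℂ) * bd θ)) * (fourier n θ * h θ)
          - φ ((rr i : ℂ) * bd θ) * (fourier n θ * (as' θ * h θ))
          = (a ((rr i : ℂ) * bd θ) - as' θ) * φ ((rr i : ℂ) * bd θ) * fourier n θ * h θ := by ring
        rw [e, norm_mul, norm_mul, norm_mul, norm_fourier_apply, mul_one]
        gcongr
        · exact (norm_sub_le _ _).trans (by linarith [ha1 _ (hdisc i θ)])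
        · exact hC _ (hdisc i θ)
      · filter_upwards [hbd.seq] with θ hθ
        have h4 : Tendsto (fun i => ‖a ((rr i : ℂ) * bd θ) - as' θ‖ * (C * ‖h θ‖)) atTop (nhds 0) := by
          have : Tendsto (fun i => a ((rr i : ℂ) * bd θ) - as' θ) atTop (nhds 0) := by
            simpa using hθ.sub_const (as' θ)
          simpa using (this.norm.mul_const (C * ‖h θ‖))
        apply squeeze_zero_norm _ h4
        intro i
        have e : (a ((rr i : ℂ) * bd θ) * φ ((rr i : ℂ) * bd θ)) * (fourier n θ * h θ)
          - φ ((rr i : ℂ) * bd θ) * (fourier n θ * (as' θ * h θ))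
          = (a ((rr i : ℂ) * bd θ) - as' θ) * φ ((rr i : ℂ) * bd θ) * fourier n θ * h θ := by ring
        rw [e, norm_mul, norm_mul, norm_mul, norm_fourier_apply, mul_one, mul_assoc]
        gcongr
        exact hC _ (hdisc i θ)
    rw [integral_zero] at h3
    refine h3.congr fun i => ?_
    rw [integral_sub ((hmul i).integrable (by norm_num)) ((hmul2 i).integrable (by norm_num)), h1, sub_zero]
  have h5 : ∀ i, ‖∫ θ, (a ((rr i : ℂ) * bd θ) * φ ((rr i : ℂ) * bd θ)) * (fourier n θ * h θ) ∂m
      - ∫ θ, fourier n θ * h θ ∂m‖ ^ 2 ≤ (2 - 2 * (a 0 * φ 0).re) * ∫ θ, ‖h θ‖ ^ 2 ∂m := by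
    intro i
    have hc := cont_dil hhol (rr_pos i).le (rr_lt i)
    have hc1 : Continuous (fun θ => a ((rr i : ℂ) * bd θ) * φ ((rr i : ℂ) * bd θ) - 1) := hc.sub continuous_const
    have hx : MemLp (fun θ => a ((rr i : ℂ) * bd θ) * φ ((rr i : ℂ) * bd θ) - 1) 2 m :=
      MemLp.of_bound hc1.aestronglyMeasurable 2 (Eventually.of_forall fun θ =>
        (norm_sub_le _ _).trans (by rw [norm_one]; linarith [hψ _ (hdisc i θ)]))
    have h6 := cs_int hx hnh
    have e : ∫ θ, (a ((rr i : ℂ) * bd θ) * φ ((rr i : ℂ) * bd θ) - 1) * (fourier n θ * h θ) ∂m =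
       ∫ θ, (a ((rr i : ℂ) * bd θ) * φ ((rr i : ℂ) * bd θ)) * (fourier n θ * h θ) ∂m
      - ∫ θ, fourier n θ * h θ ∂m := by
      rw [← integral_sub ((hmul i).integrable (by norm_num)) (hnh.integrable (by norm_num))]
      congr 1; ext θ; ring
    rw [e] at h6
    have e2 : ∫ θ, ‖fourier n θ * h θ‖ ^ 2 ∂m = ∫ θ, ‖h θ‖ ^ 2 ∂m := by
      congr 1; ext θ; rw [norm_mul, norm_fourier_apply, one_mul]
    rw [e2] at h6
    refine h6.trans (mul_le_mul_of_nonneg_right ?_ (integral_nonneg fun _ => by positivity))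
    have hci : Integrable (fun θ => a ((rr i : ℂ) * bd θ) * φ ((rr i : ℂ) * bd θ)) m :=
      Integrable.of_bound hc.aestronglyMeasurable 1 (Eventually.of_forall fun θ => hψ _ (hdisc i θ))
    have hre : ∫ θ, (a ((rr i : ℂ) * bd θ) * φ ((rr i : ℂ) * bd θ)).re ∂m = (a 0 * φ 0).re := by
      have h7 : ∫ θ, (a ((rr i : ℂ) * bd θ) * φ ((rr i : ℂ) * bd θ)).re ∂m =
        (∫ θ, a ((rr i : ℂ) * bd θ) * φ ((rr i : ℂ) * bd θ) ∂m).re := integral_re hci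
      rw [h7, mean_val hhol (rr_pos i).le (rr_lt i)]
    have hri : Integrable (fun θ => (a ((rr i : ℂ) * bd θ) * φ ((rr i : ℂ) * bd θ)).re) m := hci.re
    calc ∫ θ, ‖a ((rr i : ℂ) * bd θ) * φ ((rr i : ℂ) * bd θ) - 1‖ ^ 2 ∂m
        ≤ ∫ θ, (2 - 2 * (a ((rr i : ℂ) * bd θ) * φ ((rr i : ℂ) * bd θ)).re) ∂m := by
          apply integral_mono
          · exact hx.integrable_norm_pow (by norm_num)
          · exact (integrable_const _).sub (hri.const_mul _)
          · intro θ
            have h8 := hψ _ (hdisc i θ)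
            have h9 : ‖a ((rr i : ℂ) * bd θ) * φ ((rr i : ℂ) * bd θ)‖ ^ 2 ≤ 1 :=
              pow_le_one₀ (norm_nonneg _) h8
            rw [← Complex.normSq_eq_norm_sq] at h9
            simp only [← Complex.normSq_eq_norm_sq]
            rw [Complex.normSq_apply] at h9 ⊢
            simp only [Complex.sub_re, Complex.sub_im, Complex.one_re, Complex.one_im]
            nlinarith
      _ = 2 - 2 * (a 0 * φ 0).re := by
          rw [integral_sub (integrable_const _) (hri.const_mul _), integral_const_mul, hre]
          simp
  have h6 := (((h2.sub_const (∫ θ, fourier n θ * h θ ∂m)).norm).pow 2)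
  rw [zero_sub, norm_neg] at h6
  exact le_of_tendsto h6 (Eventually.of_forall h5)

lemma outer_cyclic {a : ℂ → ℂ} {as' h : Tc → ℂ} (ha : OuterFn a) (hbd : IsBdry a as')
    (hle : ∀ᵐ θ ∂m, ‖as' θ‖ ≤ 1) : (∀ z ∈ uDisc, ‖a z‖ ≤ 1) ∧ ∀ (_hh : MemLp h 2 m) (n : ℤ)
    (_hz : ∀ j : ℤ, n ≤ j → ∫ θ, fourier j θ * (as' θ * h θ) ∂m = 0),
    ∫ θ, fourier n θ * h θ ∂m = 0 := by
  obtain ⟨hol, α, w, hα, -, hw, hf⟩ := ha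
  set u : Tc → ℝ := fun θ => Real.log (w θ) with hu
  have hf' : ∀ z ∈ uDisc, a z = α * Ex u z := hf
  have hnorm : ∀ z ∈ uDisc, ‖a z‖ = ‖Ex u z‖ := by
    intro z hz; rw [hf' z hz, norm_mul, hα, one_mul]
  have hu0 := outer_nonpos hw hnorm hbd hle
  have ha1 : ∀ z ∈ uDisc, ‖a z‖ ≤ 1 := by
    intro z hz
    rw [hnorm z hz]
    simpa using norm_Ex_le hw hu0 hz
  refine ⟨ha1, fun hh n hz => ?_⟩
  have hαα : α * conj α = 1 := by
    rw [Complex.mul_conj, Complex.normSq_eq_norm_sq, hα]; simp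
  let uk : ℕ → Tc → ℝ := fun k θ => -(max (u θ) (-(k:ℝ)))
  have huk : ∀ k, Integrable (uk k) m := fun k => (hw.sup (integrable_const _)).neg
  have step : ∀ k : ℕ, ‖∫ θ, fourier n θ * h θ ∂m‖ ^ 2 ≤
      (2 - 2 * Real.exp (∫ θ, (u + uk k) θ ∂m)) * ∫ θ, ‖h θ‖ ^ 2 ∂m := by
    intro k
    have hprod : ∀ z ∈ uDisc, a z * (conj α * Ex (uk k) z) = Ex (u + uk k) z := by
      intro z hz
      rw [hf' z hz, ← Ex_mul hw (huk k) hz]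
      linear_combination (Ex u z * Ex (uk k) z) * hαα
    have := outer_step (φ := fun z => conj α * Ex (uk k) z) (C := Real.exp k) hol
      ((hol_Ex (huk k)).const_mul _) (fun z hz => ?_) ha1 (fun z hz => ?_) hbd hh n hz
    · rw [hprod 0 (by simp), Ex_zero, ← Complex.ofReal_exp, Complex.ofReal_re] at this
      exact this
    · rw [norm_mul, RCLike.norm_conj, hα, one_mul]
      apply norm_Ex_le (huk k) _ hz
      refine Eventually.of_forall fun θ => ?_
      simp only [uk]
      linarith [le_max_right (u θ) (-(k:ℝ))]
    · rw [hprod z hz]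
      have := norm_Ex_le (hw.add (huk k)) (C := 0) (Eventually.of_forall fun θ => ?_) hz
      · simpa using this
      · simp only [Pi.add_apply, uk]
        linarith [le_max_left (u θ) (-(k:ℝ))]
  have lim : Tendsto (fun k : ℕ => ∫ θ, (u + uk k) θ ∂m) atTop (nhds (∫ _θ, (0:ℝ) ∂m)) := by
    apply tendsto_integral_of_dominated_convergence (fun θ => |u θ|)
    · intro k; exact (hw.add (huk k)).aestronglyMeasurable
    · exact hw.abs
    · intro k
      filter_upwards [hu0] with θ hθ
      simp only [Pi.add_apply, uk, Real.norm_eq_abs]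
      have h1 := le_max_left (u θ) (-(k:ℝ))
      have h2 : max (u θ) (-(k:ℝ)) ≤ 0 := max_le hθ (by simp)
      rw [abs_of_nonpos hθ, abs_of_nonpos (by linarith)]
      linarith
    · refine Eventually.of_forall fun θ => ?_
      obtain ⟨K, hK⟩ := exists_nat_ge (-(u θ))
      refine tendsto_const_nhds.congr' ?_
      filter_upwards [eventually_ge_atTop K] with k hk
      have : (K:ℝ) ≤ k := by exact_mod_cast hk
      simp only [Pi.add_apply, uk]
      rw [max_eq_left (by linarith)]; ring
  rw [integral_zero] at lim
  have lim2 : Tendsto (fun k : ℕ => (2 - 2 * Real.exp (∫ θ, (u + uk k) θ ∂m)) * ∫ θ, ‖h θ‖ ^ 2 ∂m)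
      atTop (nhds 0) := by
    have h1 := (Real.continuous_exp.tendsto 0).comp lim
    have h2 := ((h1.const_mul 2).const_sub 2).mul_const (∫ θ, ‖h θ‖ ^ 2 ∂m)
    simpa using h2
  have h3 : ‖∫ θ, fourier n θ * h θ ∂m‖ ^ 2 ≤ 0 := ge_of_tendsto lim2 (Eventually.of_forall step)
  have h4 : ‖∫ θ, fourier n θ * h θ ∂m‖ = 0 := by
    have := sq_nonneg ‖∫ θ, fourier n θ * h θ ∂m‖
    exact pow_eq_zero_iff (two_ne_zero) |>.1 (le_antisymm h3 this)
  exact norm_eq_zero.1 h4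

lemma BPair.as_le (P : BPair) : ∀ᵐ θ ∂m, ‖P.as' θ‖ ≤ 1 := by
  filter_upwards [P.pyth] with θ h
  nlinarith [norm_nonneg (P.as' θ), sq_nonneg ‖P.bs θ‖]

/-- boundary symbol of `a` -/
def BPair.Sa (P : BPair) : Sym1 := ⟨P.as', P.a_bdry.aesm P.a_outer.1, P.as_le⟩

/-- boundary symbol of `b` -/
def BPair.Sb (P : BPair) : Sym1 := ⟨P.bs, P.b_bdry.aesm P.b_hol, P.b_bdry.norm_le P.b_le_one⟩

lemma coefM (S : Sym1) (f : L2) (n : ℤ) :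
    inner ℂ (eb n) (S.M f) = ∫ θ, fourier (-n) θ * (S.φ θ * f θ) ∂m := by
  rw [inner_eb, fourierCoeff_int]
  apply integral_congr_ae
  filter_upwards [S.coeFn_M f] with θ h
  rw [h]

lemma BPair.Sa_zero (P : BPair) {n : ℤ} (hn : 1 ≤ n) : ∫ θ, fourier n θ * P.as' θ ∂m = 0 :=
  P.a_bdry.fourier_zero P.a_outer.1 (outer_cyclic (h := 0) P.a_outer P.a_bdry P.as_le).1 hn

lemma BPair.Sb_zero (P : BPair) {n : ℤ} (hn : 1 ≤ n) : ∫ θ, fourier n θ * P.bs θ ∂m = 0 :=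
  P.b_bdry.fourier_zero P.b_hol P.b_le_one hn

lemma BPair.coef_zero (P : BPair) (h : L2) (n : ℤ)
    (hz : ∀ j : ℤ, j ≤ n → inner ℂ (eb j) (P.Sa.M h) = 0) : inner ℂ (eb n) h = 0 := by
  rw [inner_eb, fourierCoeff_int]
  apply (outer_cyclic (h := h) P.a_outer P.a_bdry P.as_le).2 (Lp.memLp h)
  intro j hj
  have := hz (-j) (by omega)
  rw [coefM, neg_neg] at this
  exact this

lemma BPair.inj1 (P : BPair) : ∀ R ∈ KH, P.Sa.cj.M R ∈ KHᗮ → R = 0 := by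
  intro R hR h
  rw [mem_KH_perp] at h
  apply eq_zero_of_coef
  intro n
  by_cases hn : n < 0
  · exact hR n hn
  have hc : ∫ θ, fourier n θ * conj (R θ) ∂m = 0 := by
    apply (outer_cyclic (h := fun θ => conj (R θ)) P.a_outer P.a_bdry P.as_le).2 (Lp.memLp R).star
    intro j hj
    have h1 := congrArg (starRingEnd ℂ) (h j (by omega))
    rw [coefM, ← integral_conj, map_zero] at h1
    rw [← h1]
    congr 1; ext θ
    rw [map_mul, ← fourier_neg, neg_neg, map_mul]
    simp [Sym1.cj, BPair.Sa]
  have h1 := congrArg (starRingEnd ℂ) hc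
  rw [← integral_conj, map_zero] at h1
  rw [inner_eb, fourierCoeff_int, ← h1]
  congr 1; ext θ
  rw [map_mul, ← fourier_neg]; simp

lemma BPair.inj2 (P : BPair) : ∀ h ∈ KHᗮ, P.Sa.M h ∈ KH → h = 0 := by
  intro h h1 h2
  rw [mem_KH_perp] at h1
  apply eq_zero_of_coef
  intro n
  by_cases hn : n < 0
  · exact P.coef_zero h n fun j hj => h2 j (by omega)
  · exact h1 n (by omega)

lemma BPair.inj3 (P : BPair) : ∀ h, P.Sa.M h = 0 → h = 0 := by
  intro h h1
  apply eq_zero_of_coef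
  intro n
  exact P.coef_zero h n fun j _ => by rw [h1, inner_zero_right]

lemma BPair.hsum (P : BPair) (x : L2) : P.Sa.cj.M (P.Sa.M x) + P.Sb.cj.M (P.Sb.M x) = x := by
  apply Lp.ext
  filter_upwards [Lp.coeFn_add (P.Sa.cj.M (P.Sa.M x)) (P.Sb.cj.M (P.Sb.M x)),
    P.Sa.cj.coeFn_M (P.Sa.M x), P.Sb.cj.coeFn_M (P.Sb.M x), P.Sa.coeFn_M x, P.Sb.coeFn_M x, P.pyth]
    with θ h1 h2 h3 h4 h5 h6
  rw [h1, Pi.add_apply, h2, h3, h4, h5]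
  simp only [Sym1.cj, BPair.Sa, BPair.Sb]
  have e1 : conj (P.as' θ) * P.as' θ = ((‖P.as' θ‖ ^ 2 : ℝ) : ℂ) := by
    rw [mul_comm, Complex.mul_conj, Complex.normSq_eq_norm_sq]
  have e2 : conj (P.bs θ) * P.bs θ = ((‖P.bs θ‖ ^ 2 : ℝ) : ℂ) := by
    rw [mul_comm, Complex.mul_conj, Complex.normSq_eq_norm_sq]
  have e3 : conj (P.as' θ) * P.as' θ + conj (P.bs θ) * P.bs θ = 1 := by
    rw [e1, e2, ← Complex.ofReal_add, h6]; simp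
  linear_combination (x θ) * e3

lemma BPair.norm_b_lt (P : BPair) {z : ℂ} (hz : z ∈ uDisc) : ‖P.b z‖ < 1 := by
  refine lt_of_le_of_ne (P.b_le_one z hz) fun h => P.b_nonconst ⟨P.b z, ?_⟩
  have := Complex.eqOn_of_isPreconnected_of_isMaxOn_norm (convex_ball (0:ℂ) 1).isPreconnected
    Metric.isOpen_ball P.b_hol hz (fun w hw => by
      simp only [Function.comp_apply, Set.mem_ofPred_eq, h]; exact P.b_le_one w hw)
  intro w hw
  exact this hw

lemma fst2_add (p q : HbP) : fst2 (p + q) = fst2 p + fst2 q := rfl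
lemma snd2_add (p q : HbP) : snd2 (p + q) = snd2 p + snd2 q := rfl
lemma fst2_smul (c : ℂ) (p : HbP) : fst2 (c • p) = c • fst2 p := rfl
lemma snd2_smul (c : ℂ) (p : HbP) : snd2 (c • p) = c • snd2 p := rfl
lemma fst2_zero : fst2 0 = 0 := rfl
lemma snd2_zero : snd2 0 = 0 := rfl
lemma fst2_sub (p q : HbP) : fst2 (p - q) = fst2 p - fst2 q := rfl

lemma inner_HbP (p q : HbP) : inner ℂ p q = inner ℂ (fst2 p) (fst2 q) + inner ℂ (snd2 p) (snd2 q) := rfl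

lemma cont_fst2 : Continuous fst2 := continuous_fst.comp (WithLp.prod_continuous_ofLp 2 L2 L2)
lemma cont_snd2 : Continuous snd2 := continuous_snd.comp (WithLp.prod_continuous_ofLp 2 L2 L2)

lemma HbMem_iff (P : BPair) (F Fp : L2) :
    HbMem P F Fp ↔ F ∈ KH ∧ Fp ∈ KH ∧ P.Sb.cj.M F - P.Sa.cj.M Fp ∈ KHᗮ := by
  unfold HbMem
  rw [mem_KH_iff_H2, mem_KH_iff_H2, mem_KH_perp]
  refine and_congr Iff.rfl (and_congr Iff.rfl (forall_congr' fun n => imp_congr Iff.rfl ?_))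
  rw [inner_eb, fourierCoeff_int, fourierCoeff_int]
  have : ∫ θ, fourier (-n) θ * (conj (P.bs θ) * F θ - conj (P.as' θ) * Fp θ) ∂m
      = ∫ θ, fourier (-n) θ * (P.Sb.cj.M F - P.Sa.cj.M Fp : L2) θ ∂m := by
    apply integral_congr_ae
    filter_upwards [Lp.coeFn_sub (P.Sb.cj.M F) (P.Sa.cj.M Fp), P.Sb.cj.coeFn_M F, P.Sa.cj.coeFn_M Fp]
      with θ h1 h2 h3
    rw [h1, Pi.sub_apply, h2, h3]
    rfl
  rw [this]

/-- the space `H(b)` as a submodule -/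
def VHb (P : BPair) : Submodule ℂ HbP where
  carrier := HbSet P
  add_mem' := by
    intro p q hp hq
    simp only [HbSet, Set.mem_ofPred_eq, HbMem_iff] at *
    obtain ⟨h1, h2, h3⟩ := hp
    obtain ⟨k1, k2, k3⟩ := hq
    refine ⟨KH.add_mem h1 k1, KH.add_mem h2 k2, ?_⟩
    rw [fst2_add, snd2_add, map_add, map_add, add_sub_add_comm]
    exact KHᗮ.add_mem h3 k3
  zero_mem' := by
    simp only [HbSet, Set.mem_ofPred_eq, HbMem_iff, fst2_zero, snd2_zero, map_zero, sub_zero]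
    exact ⟨KH.zero_mem, KH.zero_mem, KHᗮ.zero_mem⟩
  smul_mem' := by
    intro c p hp
    simp only [HbSet, Set.mem_ofPred_eq, HbMem_iff] at *
    obtain ⟨h1, h2, h3⟩ := hp
    refine ⟨KH.smul_mem c h1, KH.smul_mem c h2, ?_⟩
    rw [fst2_smul, snd2_smul, map_smul, map_smul, ← smul_sub]
    exact KHᗮ.smul_mem c h3

lemma mem_VHb {P : BPair} {p : HbP} : p ∈ VHb P ↔
    fst2 p ∈ KH ∧ snd2 p ∈ KH ∧ P.Sb.cj.M (fst2 p) - P.Sa.cj.M (snd2 p) ∈ KHᗮ :=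
  HbMem_iff P _ _

lemma isClosed_HbSet (P : BPair) : IsClosed (HbSet P) := by
  have : HbSet P = fst2 ⁻¹' (KH : Set L2) ∩ (snd2 ⁻¹' (KH : Set L2) ∩
      (fun p => P.Sb.cj.M (fst2 p) - P.Sa.cj.M (snd2 p)) ⁻¹' (KHᗮ : Submodule ℂ L2)) := by
    ext p; exact mem_VHb
  rw [this]
  refine (isClosed_KH.preimage cont_fst2).inter ((isClosed_KH.preimage cont_snd2).inter ?_)
  refine (Submodule.isClosed_orthogonal KH).preimage ?_
  exact ((P.Sb.cj.M.continuous.comp cont_fst2).sub (P.Sa.cj.M.continuous.comp cont_snd2))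

lemma one_sub_ne {lam : ℂ} (hlam : lam ∈ uDisc) (θ : Tc) : 1 - conj lam * bd θ ≠ 0 := by
  intro h
  have h1 : conj lam * bd θ = 1 := (sub_eq_zero.1 h).symm
  have h2 := congrArg norm h1
  rw [norm_mul, norm_bd, RCLike.norm_conj, mul_one, norm_one] at h2
  have : ‖lam‖ < 1 := by simpa using hlam
  linarith

lemma main_orth (P : BPair) (lam : ℂ) (hlam : lam ∈ uDisc)
    (q : HbP)
    (hbd : (fst2 q : Tc → ℂ) =ᵐ[m]
      fun θ => (1 - conj (P.b lam) * P.bs θ) * ker lam (bd θ)) (Zf : ℕ → HbP) (hZ : ZFamily P q Zf)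
    (G : HbP) (hG : G ∈ HbSet P) (hO : ∀ n, inner ℂ (Zf n) G = 0) : G = 0 := by
  obtain ⟨g1, g2, g3⟩ := mem_VHb.1 hG
  have hW : ∀ j : ℕ, fst2 (Zf j - conj lam • Zf (j + 1)) = eb j - conj (P.b lam) • P.Sb.M (eb j) := by
    intro j
    rw [fst2_sub, fst2_smul]
    apply Lp.ext
    filter_upwards [Lp.coeFn_sub (fst2 (Zf j)) (conj lam • fst2 (Zf (j + 1))),
      Lp.coeFn_smul (conj lam) (fst2 (Zf (j + 1))),
      Lp.coeFn_sub (eb j) (conj (P.b lam) • P.Sb.M (eb j)),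
      Lp.coeFn_smul (conj (P.b lam)) (P.Sb.M (eb j)), P.Sb.coeFn_M (eb j), coeFn_eb j,
      (hZ j).2, (hZ (j + 1)).2, hbd] with θ h1 h2 h3 h4 h5 h6 h7 h8 h9
    rw [h1, h3, Pi.sub_apply, Pi.sub_apply, h2, h4, Pi.smul_apply, Pi.smul_apply, h5, h6, h7, h8, h9,
      fourier_eq_bd, zpow_natCast, smul_eq_mul, smul_eq_mul]
    have hk : (1 - conj lam * bd θ) * ker lam (bd θ) = 1 := mul_inv_cancel₀ (one_sub_ne hlam θ)
    simp only [BPair.Sb]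
    rw [pow_succ]
    linear_combination (bd θ ^ j * (1 - conj (P.b lam) * P.bs θ)) * hk
  have core := abstract_core KH P.Sa.M P.Sa.cj.M P.Sb.M P.Sb.cj.M P.Sa.adj P.Sb.adj
    (fun x hx => P.Sa.M_mem (fun n hn => P.Sa_zero hn) hx)
    (fun x hx => P.Sb.M_mem (fun n hn => P.Sb_zero hn) hx)
    (fun x => Sym1.comm _ _ x) (fun x => Sym1.comm _ _ x) (fun x => Sym1.comm _ _ x)
    P.hsum (Sym1.norm_M _) (P.b lam) (P.norm_b_lt hlam) P.inj1 P.inj2 P.inj3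
    (Set.range fun n : ℕ => eb n) (by rintro _ ⟨n, rfl⟩; exact eb_mem (by positivity))
    (by
      intro x hx h
      apply eq_zero_of_coef
      intro n
      by_cases hn : n < 0
      · exact hx n hn
      · obtain ⟨k, rfl⟩ : ∃ k : ℕ, n = (k : ℤ) := ⟨n.toNat, by omega⟩
        exact h _ ⟨k, rfl⟩)
    (fst2 G) (snd2 G) g1 g2 g3 ?_
  · have : G.ofLp = (0 : L2 × L2) := Prod.ext core.1 core.2
    exact (WithLp.ofLp_injective 2) this
  rintro _ ⟨n, rfl⟩
  set c : ℕ → ℂ := fun j => inner ℂ (eb j) (P.Sa.cj.M (eb n)) with hc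
  set X : HbP := ∑ j ∈ Finset.range (n + 1), c j • (Zf j - conj lam • Zf (j + 1)) with hX
  have hXV : X ∈ VHb P := by
    refine Submodule.sum_mem _ fun j _ => Submodule.smul_mem _ _ (Submodule.sub_mem _ (hZ j).1
      (Submodule.smul_mem _ _ (hZ (j + 1)).1))
  have hXG : inner ℂ X G = 0 := by
    rw [hX, sum_inner]
    refine Finset.sum_eq_zero fun j _ => ?_
    rw [inner_smul_left, inner_sub_left, inner_smul_left, hO, hO]; simp
  have hX1 : fst2 X = (∑ j ∈ Finset.range (n + 1), c j • eb j)
      - conj (P.b lam) • P.Sb.M (∑ j ∈ Finset.range (n + 1), c j • eb j) := by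
    have e : fst2 X = ∑ j ∈ Finset.range (n + 1), c j • fst2 (Zf j - conj lam • Zf (j + 1)) := by
      let L : HbP →ₗ[ℂ] L2 := { toFun := fst2, map_add' := fst2_add, map_smul' := fst2_smul }
      have : L X = ∑ j ∈ Finset.range (n + 1), c j • L (Zf j - conj lam • Zf (j + 1)) := by
        rw [hX, map_sum]; simp_rw [map_smul]
      exact this
    rw [e, map_sum, Finset.smul_sum, ← Finset.sum_sub_distrib]
    refine Finset.sum_congr rfl fun j _ => ?_
    rw [hW, map_smul, smul_sub, smul_comm]
  obtain ⟨x1, x2, x3⟩ := mem_VHb.1 hXV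
  refine ⟨∑ j ∈ Finset.range (n + 1), c j • eb j, ?_, ?_, snd2 X, x2, ?_, ?_⟩
  · exact KH.sum_mem fun j _ => KH.smul_mem _ (eb_mem (by positivity))
  · rw [mem_KH_perp]
    intro k hk
    obtain ⟨k, rfl⟩ : ∃ i : ℕ, k = (i : ℤ) := ⟨k.toNat, by omega⟩
    rw [inner_sub_right, inner_sum]
    simp_rw [inner_smul_right, inner_eb_eb]
    by_cases hkn : k < n + 1
    · rw [Finset.sum_eq_single k]
      · simp [hc]
      · intro b _ hb
        rw [if_neg (by exact_mod_cast hb.symm), mul_zero]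
      · intro h; exact absurd (Finset.mem_range.2 hkn) h
    · rw [Finset.sum_eq_zero, sub_zero]
      · have h0 := P.Sa_zero (n := (k : ℤ) - n) (by omega)
        rw [← inner_conj_symm, P.Sa.adj, inner_eb_M]
        exact (congrArg (starRingEnd ℂ) h0).trans (map_zero _)
      · intro j hj
        have := Finset.mem_range.1 hj
        rw [if_neg (by omega), mul_zero]
  · rw [← hX1]; exact x3
  · rw [← hX1, ← inner_HbP]; exact hXG

/-- For every `λ ∈ 𝔻`, the reproducing kernel
`k_λ^b(z) = (1 - conj(b(λ))·b(z))/(1 - conj(λ)·z)` of `H(b)` is cyclic for `S_b`. -/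
theorem stmt_17 (P : BPair) (lam : ℂ) (hlam : lam ∈ uDisc)
    (q : HbP) (hq : q ∈ HbSet P)
    (hbd : (fst2 q : Tc → ℂ) =ᵐ[m]
      fun θ => (1 - conj (P.b lam) * P.bs θ) * ker lam (bd θ)) :
    CyclicSb P q := by
  refine ⟨hq, fun Zf hZ => ?_⟩
  have hsub : Submodule.span ℂ (Set.range Zf) ≤ VHb P := by
    rw [Submodule.span_le]
    rintro _ ⟨n, rfl⟩
    exact (hZ n).1
  apply Set.Subset.antisymm
  · exact closure_minimal hsub (isClosed_HbSet P)
  · intro x hx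
    set W := (Submodule.span ℂ (Set.range Zf)).topologicalClosure with hWd
    have hWc : IsClosed (W : Set HbP) := Submodule.isClosed_topologicalClosure _
    have : CompleteSpace W := hWc.completeSpace_coe
    have hWV : W ≤ VHb P := Submodule.topologicalClosure_minimal _ hsub (isClosed_HbSet P)
    have hp : W.starProjection x ∈ W := Submodule.starProjection_apply_mem W x
    have hz : x - W.starProjection x = 0 := by
      apply main_orth P lam hlam q hbd Zf hZ
      · exact (VHb P).sub_mem hx (hWV hp)
      · intro n
        exact Submodule.sub_starProjection_mem_orthogonal x _
          (Submodule.le_topologicalClosure _ (Submodule.subset_span ⟨n, rfl⟩))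
    have hxW : x ∈ W := by rw [sub_eq_zero.1 hz]; exact hp
    exact hxW

end
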